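/- arXiv:1603.08843 — 2 statements merged into one kernel-verified Lean document; each statement's English description precedes it below -/
import Mathlib

section
/- Let ψ : ℝ → ℂ be a Schwartz function with ψ(0) ≠ 0, a_m := 2^{((6m−1)^{6m−1})}, and F(ξ) := Σ_{m=1}^∞ ψ(ξ − a_m). Then there is no Schwartz function g : ℝ → ℂ with g(ξ) = F(ξ) for all ξ ∈ ℝ; i.e. F, although smooth and bounded with all derivatives bounded, is not a Schwartz function. -/
/-- The scale `ε_n = 2^{-(n^n)}`. -/
noncomputable def eps (n : ℕ) : ℝ := ((2 : ℝ) ^ (n ^ n))⁻¹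

/-- The translation points `a_m = ε_{6m-1}⁻¹ = 2^{((6m-1)^{6m-1})}`. -/
noncomputable def a (m : ℕ) : ℝ := (eps (6 * m - 1))⁻¹

/-- The sum `F(ξ) = Σ_{m=1}^∞ ψ(ξ − a_m)`. -/
noncomputable def F (ψ : SchwartzMap ℝ ℂ) (ξ : ℝ) : ℂ := ∑' m : ℕ, ψ (ξ - a (m + 1))

open Filter Topology

lemma a_eq (m : ℕ) : a m = 2 ^ ((6 * m - 1) ^ (6 * m - 1)) := by
  simp [a, eps]

lemma two_mul_a_succ_le {j k : ℕ} (h : j < k) : 2 * a (j + 1) ≤ a (k + 1) := by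
  rw [a_eq, a_eq, ← pow_succ']
  refine pow_le_pow_right₀ one_le_two ?_
  calc (6 * (j + 1) - 1) ^ (6 * (j + 1) - 1)
      < (6 * (k + 1) - 1) ^ (6 * (j + 1) - 1) := Nat.pow_lt_pow_left (by omega) (by omega)
    _ ≤ (6 * (k + 1) - 1) ^ (6 * (k + 1) - 1) := Nat.pow_le_pow_right (by omega) (by omega)

lemma two_mul_le_a_succ (m : ℕ) : 2 * ((m : ℝ) + 1) ≤ a (m + 1) := by
  rw [a_eq]
  have h₁ : 6 * (m + 1) - 1 ≤ (6 * (m + 1) - 1) ^ (6 * (m + 1) - 1) :=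
    Nat.le_self_pow (by omega) _
  have h₂ : (6 * (m + 1) - 1) ^ (6 * (m + 1) - 1) < 2 ^ (6 * (m + 1) - 1) ^ (6 * (m + 1) - 1) :=
    Nat.lt_two_pow_self
  have h₃ : 2 * (m + 1) ≤ 2 ^ (6 * (m + 1) - 1) ^ (6 * (m + 1) - 1) := by omega
  exact_mod_cast h₃

lemma le_abs_a_sub {k m : ℕ} (h : m ≠ k) : (m : ℝ) + 1 ≤ |a (k + 1) - a (m + 1)| := by
  have hm := two_mul_le_a_succ m
  have h0 : (0 : ℝ) ≤ m := m.cast_nonneg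
  rcases lt_or_gt_of_ne h with h | h
  · have := two_mul_a_succ_le h
    exact le_trans (by linarith) (le_abs_self _)
  · have := two_mul_a_succ_le h
    exact le_trans (by linarith) (neg_le_abs _)

lemma tendsto_a_succ : Tendsto (fun k : ℕ => a (k + 1)) atTop atTop := by
  refine tendsto_atTop_mono (fun k => ?_) tendsto_natCast_atTop_atTop
  have := two_mul_le_a_succ k
  have h0 : (0 : ℝ) ≤ k := k.cast_nonneg
  linarith

lemma SchwartzMap.tendsto_comp_atTop (f : SchwartzMap ℝ ℂ) {u : ℕ → ℝ}
    (hu : Tendsto u atTop atTop) : Tendsto (fun k => f (u k)) atTop (𝓝 0) :=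
  (zero_at_infty f).comp (hu.mono_right atTop_le_cocompact)

lemma SchwartzMap.exists_norm_a_sub_le (ψ : SchwartzMap ℝ ℂ) :
    ∃ C : ℝ, ∀ k m : ℕ, m ≠ k →
      ‖ψ (a (k + 1) - a (m + 1))‖ ≤ C * (1 / ((m + 1 : ℕ) : ℝ) ^ 2) := by
  obtain ⟨C, -, hC⟩ := ψ.decay 2 0
  refine ⟨C, fun k m h => ?_⟩
  have hx := hC (a (k + 1) - a (m + 1))
  rw [norm_iteratedFDeriv_zero, Real.norm_eq_abs] at hx
  have hpos : (0 : ℝ) < ((m + 1 : ℕ) : ℝ) ^ 2 := by positivity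
  rw [mul_one_div, le_div_iff₀ hpos, mul_comm]
  refine le_trans (mul_le_mul_of_nonneg_right ?_ (norm_nonneg _)) hx
  push_cast
  exact pow_le_pow_left₀ (by positivity) (le_abs_a_sub h) 2

lemma tendsto_F_a_succ (ψ : SchwartzMap ℝ ℂ) :
    Tendsto (fun k : ℕ => F ψ (a (k + 1))) atTop (𝓝 (ψ 0)) := by
  obtain ⟨C, hC⟩ := ψ.exists_norm_a_sub_le
  have hsum : Summable fun m : ℕ => C * (1 / ((m + 1 : ℕ) : ℝ) ^ 2) :=
    ((summable_nat_add_iff 1).2 (Real.summable_one_div_nat_pow.2 one_lt_two)).mul_left C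
  have hF (k : ℕ) : F ψ (a (k + 1)) =
      ψ 0 + ∑' m : ℕ, if m = k then 0 else ψ (a (k + 1) - a (m + 1)) := by
    have hs : Summable fun m : ℕ => ψ (a (k + 1) - a (m + 1)) := by
      refine hsum.of_norm_bounded_eventually_nat ?_
      filter_upwards [eventually_gt_atTop k] with m hm using hC k m hm.ne'
    rw [F, hs.tsum_eq_add_tsum_ite k, sub_self]
  have hlim : Tendsto (fun k : ℕ => ∑' m : ℕ, if m = k then 0 else ψ (a (k + 1) - a (m + 1)))
      atTop (𝓝 (∑' _ : ℕ, (0 : ℂ))) := by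
    refine tendsto_tsum_of_dominated_convergence hsum (fun m => ?_)
      (Eventually.of_forall fun k m => ?_)
    · refine (ψ.tendsto_comp_atTop
        (tendsto_atTop_add_const_right _ (-a (m + 1)) tendsto_a_succ)).congr' ?_
      filter_upwards [eventually_gt_atTop m] with k hk
      rw [if_neg hk.ne, sub_eq_add_neg]
    · split_ifs with h
      · rw [norm_zero]
        exact (norm_nonneg _).trans (hC (m + 1) m (by omega))
      · exact hC k m h
  simp_rw [hF]
  simpa using hlim.const_add (ψ 0)

/-- If `ψ(0) ≠ 0` then `F` is not (equal to) a Schwartz function. -/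
theorem stmt6 (ψ : SchwartzMap ℝ ℂ) (hψ : ψ 0 ≠ 0) :
    ¬ ∃ g : SchwartzMap ℝ ℂ, ∀ ξ : ℝ, g ξ = F ψ ξ := by
  rintro ⟨g, hg⟩
  have h := g.tendsto_comp_atTop tendsto_a_succ
  simp_rw [hg] at h
  exact hψ (tendsto_nhds_unique (tendsto_F_a_succ ψ) h)
end

section
/- (Complementary-ultrafilter case.) Let ψ, φ : ℝ → ℂ be Schwartz functions, ε_n := 2^{-(n^n)}, b_m := ε_{6m+2}^{−1} for m ≥ 0, and G(ξ) := Σ_{m=0}^∞ ψ(ξ − b_m). Then the series converges absolutely, G is bounded and smooth, and for every p ∈ ℕ there exists N ∈ ℕ such that for all n ≥ N, all ε ∈ (ε_{6n}, ε_{6n−3}], and all ξ ∈ ℝ, one has (1+ξ²)^{p/2} · |G(ξ)| · |(𝓕φ)(εξ)| ≤ ε^{−1}. -/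
open scoped FourierTransform

/-- The translation points `b_m = ε_{6m+2}⁻¹ = 2^{((6m+2)^{6m+2})}` (`m ≥ 0`). -/
noncomputable def b (m : ℕ) : ℝ := (eps (6 * m + 2))⁻¹

/-- The sum `G(ξ) = Σ_{m=0}^∞ ψ(ξ − b_m)`. -/
noncomputable def G (ψ : SchwartzMap ℝ ℂ) (ξ : ℝ) : ℂ := ∑' m : ℕ, ψ (ξ - b m)

theorem mul_self_pow_le_succ {c k : ℕ} (h : c ≤ k + 1) : c * k ^ k ≤ (k + 1) ^ (k + 1) :=
  calc c * k ^ k ≤ (k + 1) * (k + 1) ^ k := by gcongr; omega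
    _ = (k + 1) ^ (k + 1) := by ring

theorem eps_pos (k : ℕ) : 0 < eps k := by unfold eps; positivity

theorem inv_eps (k : ℕ) : (eps k)⁻¹ = 2 ^ (k ^ k) := by simp [eps]

theorem inv_eps_pow_le_succ {c k : ℕ} (h : c ≤ k + 1) : (eps k)⁻¹ ^ c ≤ (eps (k + 1))⁻¹ := by
  rw [inv_eps, inv_eps, ← pow_mul, mul_comm]
  exact pow_le_pow_right₀ one_le_two (mul_self_pow_le_succ h)

theorem inv_eps_monotone : Monotone fun k => (eps k)⁻¹ :=
  monotone_nat_of_le_succ fun k => by simpa using inv_eps_pow_le_succ (c := 1) (k := k) (by omega)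

theorem self_le_inv_eps (k : ℕ) : (k : ℝ) ≤ (eps k)⁻¹ := by
  rw [inv_eps]
  have h : k ≤ 2 ^ (k ^ k) := by
    rcases Nat.eq_zero_or_pos k with rfl | hk
    · simp
    · exact (Nat.le_self_pow hk.ne' k).trans Nat.lt_two_pow_self.le
  exact_mod_cast h

theorem b_monotone : Monotone b := fun i j h => inv_eps_monotone (by omega : 6 * i + 2 ≤ 6 * j + 2)

theorem two_le_b (m : ℕ) : 2 ≤ b m :=
  le_trans (by push_cast; linarith [(Nat.cast_nonneg m : (0 : ℝ) ≤ m)]) (self_le_inv_eps (6 * m + 2))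

theorem self_le_b (m : ℕ) : (m : ℝ) ≤ b m :=
  le_trans (by push_cast; linarith [(Nat.cast_nonneg m : (0 : ℝ) ≤ m)]) (self_le_inv_eps (6 * m + 2))

theorem b_strictMono : StrictMono b := strictMono_nat_of_lt_succ fun m => by
  have h₁ : b m ^ 2 ≤ b (m + 1) :=
    (inv_eps_pow_le_succ (k := 6 * m + 2) (by omega)).trans
      (inv_eps_monotone (by omega : 6 * m + 2 + 1 ≤ 6 * (m + 1) + 2))
  nlinarith [two_le_b m]

/-- The points `b m` are integers. -/
theorem exists_int_injective_eq_b : ∃ e : ℕ → ℤ, Function.Injective e ∧ ∀ m, b m = e m := by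
  have h : ∀ m, b m = ((2 ^ ((6 * m + 2) ^ (6 * m + 2)) : ℤ) : ℝ) := fun m => by
    simp [b, inv_eps]
  exact ⟨_, fun i j hij => b_strictMono.injective (by rw [h, h]; exact congrArg _ hij), h⟩

theorem summable_four_div_one_add_abs_int_sq :
    Summable fun i : ℤ => 4 / (1 + |(i : ℝ)|) ^ 2 := by
  have h : Summable fun n : ℕ => 4 / (1 + (n : ℝ)) ^ 2 := by
    have := ((summable_nat_add_iff 1).2 (Real.summable_one_div_nat_pow.2 one_lt_two)).mul_left 4
    refine this.congr fun n => ?_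
    push_cast
    rw [add_comm, mul_one_div]
  exact Summable.of_nat_of_neg (by simpa using h) (by simpa using h)

/-- The inverse-square weights centred at the points `b m` are summable, uniformly in `ξ`. -/
theorem exists_tsum_inv_sq_le : ∃ S : ℝ, 0 ≤ S ∧ ∀ ξ : ℝ,
    Summable (fun m => ((1 + |ξ - b m|) ^ 2)⁻¹) ∧ ∑' m, ((1 + |ξ - b m|) ^ 2)⁻¹ ≤ S := by
  obtain ⟨e, he, hb⟩ := exists_int_injective_eq_b
  have hs := summable_four_div_one_add_abs_int_sq
  refine ⟨∑' i : ℤ, 4 / (1 + |(i : ℝ)|) ^ 2, tsum_nonneg fun _ => by positivity, fun ξ => ?_⟩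
  have hinj : Function.Injective fun m => e m - ⌊ξ⌋ := fun i j h => he (by simpa using h)
  have hle : ∀ m, ((1 + |ξ - b m|) ^ 2)⁻¹ ≤ 4 / (1 + |((e m - ⌊ξ⌋ : ℤ) : ℝ)|) ^ 2 := fun m => by
    rw [inv_eq_one_div, div_le_div_iff₀ (by positivity) (by positivity)]
    have h₁ : |((e m - ⌊ξ⌋ : ℤ) : ℝ)| ≤ |ξ - b m| + 1 := by
      push_cast
      rw [hb]
      have h₂ := Int.floor_le ξ
      have h₃ := Int.lt_floor_add_one ξ
      rcases abs_cases ((e m : ℝ) - ⌊ξ⌋) with h | h <;> rcases abs_cases (ξ - e m) with h' | h' <;>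
        linarith
    calc 1 * (1 + |((e m - ⌊ξ⌋ : ℤ) : ℝ)|) ^ 2 ≤ 1 * (2 * (1 + |ξ - b m|)) ^ 2 := by
          gcongr
          linarith [abs_nonneg (ξ - b m)]
      _ = 4 * (1 + |ξ - b m|) ^ 2 := by ring
  have hsum : Summable fun m => 4 / (1 + |((e m - ⌊ξ⌋ : ℤ) : ℝ)|) ^ 2 := hs.comp_injective hinj
  have hsum' := Summable.of_nonneg_of_le (fun m => by positivity) hle hsum
  exact ⟨hsum', (hsum'.tsum_le_tsum hle hsum).trans
    (tsum_comp_le_tsum_of_inj hs (fun _ => by positivity) hinj)⟩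

theorem SchwartzMap.exists_one_add_abs_pow_mul_norm_le (ψ : SchwartzMap ℝ ℂ) (k : ℕ) :
    ∃ D : ℝ, 0 ≤ D ∧ ∀ x : ℝ, (1 + |x|) ^ k * ‖ψ x‖ ≤ D := by
  have h := fun x => SchwartzMap.one_add_le_sup_seminorm_apply (𝕜 := ℝ) (m := (k, 0))
    le_rfl le_rfl ψ x
  simp only [norm_iteratedFDeriv_zero, Real.norm_eq_abs] at h
  exact ⟨_, le_trans (by positivity) (h 0), h⟩

theorem summable_norm_translates (ψ : SchwartzMap ℝ ℂ) (ξ : ℝ) :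
    Summable fun m => ‖ψ (ξ - b m)‖ := by
  obtain ⟨S, -, hS⟩ := exists_tsum_inv_sq_le
  obtain ⟨D, -, hD⟩ := ψ.exists_one_add_abs_pow_mul_norm_le 2
  refine Summable.of_nonneg_of_le (fun _ => norm_nonneg _) (fun m => ?_) ((hS ξ).1.mul_left D)
  rw [← div_eq_mul_inv, le_div_iff₀ (by positivity), mul_comm]
  exact hD _

/-- If `ξ` stays away from all `b m` in proportion to its size, `G ψ ξ` decays rapidly. -/
theorem exists_one_add_abs_pow_mul_norm_G_le (ψ : SchwartzMap ℝ ℂ) (p : ℕ) :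
    ∃ C : ℝ, 0 ≤ C ∧ ∀ ξ : ℝ, (∀ m, 1 + |ξ| ≤ 2 * (1 + |ξ - b m|)) →
      (1 + |ξ|) ^ p * ‖G ψ ξ‖ ≤ C := by
  obtain ⟨S, hS₀, hS⟩ := exists_tsum_inv_sq_le
  obtain ⟨D, hD₀, hD⟩ := ψ.exists_one_add_abs_pow_mul_norm_le (p + 2)
  refine ⟨2 ^ p * D * S, by positivity, fun ξ hξ => ?_⟩
  have hterm : ∀ m, (1 + |ξ|) ^ p * ‖ψ (ξ - b m)‖ ≤
      2 ^ p * D * ((1 + |ξ - b m|) ^ 2)⁻¹ := fun m => by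
    rw [← div_eq_mul_inv, le_div_iff₀ (by positivity)]
    calc (1 + |ξ|) ^ p * ‖ψ (ξ - b m)‖ * (1 + |ξ - b m|) ^ 2
        ≤ (2 * (1 + |ξ - b m|)) ^ p * ‖ψ (ξ - b m)‖ * (1 + |ξ - b m|) ^ 2 := by
          gcongr
          exact hξ m
      _ = 2 ^ p * ((1 + |ξ - b m|) ^ (p + 2) * ‖ψ (ξ - b m)‖) := by rw [mul_pow]; ring
      _ ≤ 2 ^ p * D := by gcongr; exact hD _
  have hsum := summable_norm_translates ψ ξ
  calc (1 + |ξ|) ^ p * ‖G ψ ξ‖ ≤ (1 + |ξ|) ^ p * ∑' m, ‖ψ (ξ - b m)‖ := by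
        gcongr
        exact norm_tsum_le_tsum_norm hsum
    _ = ∑' m, (1 + |ξ|) ^ p * ‖ψ (ξ - b m)‖ := tsum_mul_left.symm
    _ ≤ ∑' m, 2 ^ p * D * ((1 + |ξ - b m|) ^ 2)⁻¹ :=
        (hsum.mul_left _).tsum_le_tsum hterm ((hS ξ).1.mul_left _)
    _ = 2 ^ p * D * ∑' m, ((1 + |ξ - b m|) ^ 2)⁻¹ := tsum_mul_left
    _ ≤ 2 ^ p * D * S := by gcongr; exact (hS ξ).2

theorem exists_norm_G_le (ψ : SchwartzMap ℝ ℂ) : ∃ C : ℝ, 0 ≤ C ∧ ∀ ξ, ‖G ψ ξ‖ ≤ C := by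
  obtain ⟨S, hS₀, hS⟩ := exists_tsum_inv_sq_le
  obtain ⟨D, hD₀, hD⟩ := ψ.exists_one_add_abs_pow_mul_norm_le 2
  refine ⟨D * S, by positivity, fun ξ => ?_⟩
  have hterm : ∀ m, ‖ψ (ξ - b m)‖ ≤ D * ((1 + |ξ - b m|) ^ 2)⁻¹ := fun m => by
    rw [← div_eq_mul_inv, le_div_iff₀ (by positivity), mul_comm]
    exact hD _
  calc ‖G ψ ξ‖ ≤ ∑' m, D * ((1 + |ξ - b m|) ^ 2)⁻¹ :=
        tsum_of_norm_bounded ((hS ξ).1.mul_left D).hasSum hterm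
    _ = D * ∑' m, ((1 + |ξ - b m|) ^ 2)⁻¹ := tsum_mul_left
    _ ≤ D * S := by gcongr; exact (hS ξ).2

theorem hasDerivAt_G (ψ : SchwartzMap ℝ ℂ) (ξ : ℝ) :
    HasDerivAt (G ψ) (G (SchwartzMap.derivCLM ℝ ℂ ψ) ξ) ξ := by
  obtain ⟨S, -, hS⟩ := exists_tsum_inv_sq_le
  obtain ⟨D, hD₀, hD⟩ := (SchwartzMap.derivCLM ℝ ℂ ψ).exists_one_add_abs_pow_mul_norm_le 2
  obtain ⟨R, hR, hξR⟩ : ∃ R : ℝ, 0 ≤ R ∧ |ξ| < R := ⟨|ξ| + 1, by positivity, lt_add_one _⟩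
  have hmem : ξ ∈ Metric.ball (0 : ℝ) R := by simpa using hξR
  refine hasDerivAt_tsum_of_isPreconnected (g := fun m y => ψ (y - b m))
    (g' := fun m y => SchwartzMap.derivCLM ℝ ℂ ψ (y - b m))
    ((hS 0).1.mul_left (D * (1 + R) ^ 2)) Metric.isOpen_ball
    (convex_ball 0 R).isPreconnected (fun m y _ => ?_) (fun m y hy => ?_)
    hmem (summable_norm_translates ψ ξ).of_norm hmem
  · exact (ψ.hasDerivAt (y - b m)).comp_sub_const y (b m)
  · have hy' : |y| ≤ R := by simpa using (Metric.mem_ball.1 hy).le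
    rw [← div_eq_mul_inv, le_div_iff₀ (by positivity)]
    have h : 1 + |0 - b m| ≤ (1 + R) * (1 + |y - b m|) := by
      have := abs_sub_le 0 y (b m)
      rw [zero_sub y, abs_neg] at this
      nlinarith [mul_nonneg hR (abs_nonneg (y - b m))]
    calc _ ≤ ‖SchwartzMap.derivCLM ℝ ℂ ψ (y - b m)‖ * ((1 + R) * (1 + |y - b m|)) ^ 2 := by
          gcongr
      _ = (1 + R) ^ 2 * ((1 + |y - b m|) ^ 2 * ‖SchwartzMap.derivCLM ℝ ℂ ψ (y - b m)‖) := by ring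
      _ ≤ (1 + R) ^ 2 * D := by gcongr; exact hD _
      _ = D * (1 + R) ^ 2 := mul_comm _ _

theorem contDiff_G (ψ : SchwartzMap ℝ ℂ) : ContDiff ℝ (⊤ : ℕ∞) (G ψ) := by
  refine contDiff_infty.2 fun n => ?_
  induction n generalizing ψ with
  | zero =>
    exact contDiff_zero.2 (continuous_iff_continuousAt.2 fun ξ => (hasDerivAt_G ψ ξ).continuousAt)
  | succ n ih =>
    have hderiv : deriv (G ψ) = G (SchwartzMap.derivCLM ℝ ℂ ψ) :=
      funext fun ξ => (hasDerivAt_G ψ ξ).deriv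
    push_cast
    refine contDiff_succ_iff_deriv.2
      ⟨fun ξ => (hasDerivAt_G ψ ξ).differentiableAt, by simp, ?_⟩
    rw [hderiv]
    exact ih _

theorem one_add_sq_rpow_half_le (ξ : ℝ) (p : ℕ) :
    (1 + ξ ^ 2) ^ ((p : ℝ) / 2) ≤ (1 + |ξ|) ^ p := by
  have h : 1 + ξ ^ 2 ≤ (1 + |ξ|) ^ 2 := by nlinarith [sq_abs ξ, abs_nonneg ξ]
  calc (1 + ξ ^ 2) ^ ((p : ℝ) / 2) ≤ ((1 + |ξ|) ^ 2) ^ ((p : ℝ) / 2) := by gcongr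
    _ = (1 + |ξ|) ^ p := by
      rw [← Real.rpow_natCast _ 2, ← Real.rpow_mul (by positivity)]
      norm_num [mul_div_cancel₀]

/-- Between the scales `b j` and `b (j + 1)`, points are far from every `b m`. -/
theorem one_add_abs_le_two_mul {j : ℕ} {ξ : ℝ} (h₁ : 2 * b j ≤ |ξ|) (h₂ : 2 * |ξ| ≤ b (j + 1))
    (m : ℕ) : 1 + |ξ| ≤ 2 * (1 + |ξ - b m|) := by
  have hb := two_le_b m
  rcases le_or_gt m j with hm | hm
  · have := b_monotone hm
    have := abs_sub_abs_le_abs_sub ξ (b m)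
    rw [abs_of_nonneg (by linarith : 0 ≤ b m)] at this
    linarith
  · have := b_monotone (Nat.succ_le_of_lt hm)
    have := abs_sub_abs_le_abs_sub (b m) ξ
    rw [abs_sub_comm, abs_of_nonneg (by linarith : 0 ≤ b m)] at this
    simp only [Nat.succ_eq_add_one] at *
    linarith

/-- The weighted product is bounded once `ξ` lies beyond `2 * b j`, uniformly in `ε`, as long as
`ε` is not too small compared to `b (j + 1)`. -/
theorem exists_weighted_bound (ψ φ : SchwartzMap ℝ ℂ) (p : ℕ) :
    ∃ C : ℝ, 0 ≤ C ∧ ∀ (j : ℕ) (ε ξ : ℝ), 0 < ε → 2 * ε⁻¹ ^ 2 ≤ b (j + 1) →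
      2 * b j ≤ |ξ| → (1 + |ξ|) ^ p * ‖G ψ ξ‖ * ‖φ (ε * ξ)‖ ≤ C := by
  obtain ⟨A, hA₀, hA⟩ := exists_norm_G_le ψ
  obtain ⟨B, hB₀, hB⟩ := exists_one_add_abs_pow_mul_norm_G_le ψ p
  obtain ⟨D, hD₀, hD⟩ := φ.exists_one_add_abs_pow_mul_norm_le 0
  obtain ⟨E, hE₀, hE⟩ := φ.exists_one_add_abs_pow_mul_norm_le (2 * p)
  simp only [pow_zero, one_mul] at hD
  refine ⟨B * D + 2 ^ p * A * E, by positivity, fun j ε ξ hε hεb hξ => ?_⟩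
  rcases le_or_gt |ξ| (ε⁻¹ ^ 2) with h | h
  · calc (1 + |ξ|) ^ p * ‖G ψ ξ‖ * ‖φ (ε * ξ)‖ ≤ B * D := by
          gcongr
          · exact hB ξ (one_add_abs_le_two_mul hξ (by linarith))
          · exact hD _
      _ ≤ _ := le_add_of_nonneg_right (by positivity)
  · have hξ₁ : 1 ≤ |ξ| := by linarith [two_le_b j]
    have hsq : |ξ| ≤ (1 + |ε * ξ|) ^ 2 := by
      have h₁ : 1 ≤ |ξ| * ε ^ 2 := by
        rw [inv_pow, inv_lt_iff_one_lt_mul₀ (by positivity)] at h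
        linarith
      have h₂ : |ε * ξ| ^ 2 = |ξ| * (|ξ| * ε ^ 2) := by
        rw [abs_mul, abs_of_pos hε]; ring
      nlinarith [abs_nonneg (ε * ξ)]
    calc (1 + |ξ|) ^ p * ‖G ψ ξ‖ * ‖φ (ε * ξ)‖
        ≤ (2 * (1 + |ε * ξ|) ^ 2) ^ p * A * ‖φ (ε * ξ)‖ := by
          gcongr
          · linarith
          · exact hA ξ
      _ = 2 ^ p * A * ((1 + |ε * ξ|) ^ (2 * p) * ‖φ (ε * ξ)‖) := by rw [mul_pow, ← pow_mul]; ring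
      _ ≤ 2 ^ p * A * E := by gcongr; exact hE _
      _ ≤ _ := le_add_of_nonneg_left (by positivity)

/-- The moderateness estimate for a Schwartz function in place of `𝓕 φ`. -/
theorem exists_forall_weighted_le_inv (ψ φ : SchwartzMap ℝ ℂ) (p : ℕ) :
    ∃ N : ℕ, ∀ n : ℕ, N ≤ n → ∀ ε : ℝ, eps (6 * n) < ε → ε ≤ eps (6 * n - 3) →
      ∀ ξ : ℝ, (1 + |ξ|) ^ p * ‖G ψ ξ‖ * ‖φ (ε * ξ)‖ ≤ ε⁻¹ := by
  obtain ⟨A, hA₀, hA⟩ := exists_norm_G_le ψ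
  obtain ⟨D, hD₀, hD⟩ := φ.exists_one_add_abs_pow_mul_norm_le 0
  obtain ⟨C, hC₀, hC⟩ := exists_weighted_bound ψ φ p
  simp only [pow_zero, one_mul] at hD
  obtain ⟨N, hN⟩ := exists_nat_ge (max C (3 ^ p * A * D))
  refine ⟨N + p + 1, fun n hn ε hε₁ hε₂ ξ => ?_⟩
  obtain ⟨j, rfl⟩ : ∃ j, n = j + 1 := ⟨n - 1, by omega⟩
  have hε₀ : 0 < ε := (eps_pos _).trans hε₁
  have hj : max C (3 ^ p * A * D) ≤ b j :=
    (hN.trans (by exact_mod_cast (by omega : N ≤ j))).trans (self_le_b j)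
  have hb := two_le_b j
  have hinv : b j ^ (p + 1) ≤ ε⁻¹ :=
    calc b j ^ (p + 1) ≤ (eps (6 * (j + 1) - 3))⁻¹ :=
          inv_eps_pow_le_succ (k := 6 * j + 2) (by omega)
      _ ≤ ε⁻¹ := inv_anti₀ hε₀ hε₂
  have hbε : b j ≤ ε⁻¹ := (le_self_pow₀ (by linarith) (by omega)).trans hinv
  rcases le_or_gt (2 * b j) |ξ| with h | h
  · have hinv₃ : ε⁻¹ ^ 3 ≤ b (j + 1) :=
      calc ε⁻¹ ^ 3 ≤ (eps (6 * (j + 1)))⁻¹ ^ 3 := by gcongr; exact eps_pos _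
        _ ≤ (eps (6 * (j + 1) + 1))⁻¹ := inv_eps_pow_le_succ (by omega)
        _ ≤ b (j + 1) := inv_eps_monotone (by omega : 6 * (j + 1) + 1 ≤ 6 * (j + 1) + 2)
    refine (hC j ε ξ hε₀ ?_ h).trans (((le_max_left _ _).trans hj).trans hbε)
    nlinarith [sq_nonneg ε⁻¹]
  · calc (1 + |ξ|) ^ p * ‖G ψ ξ‖ * ‖φ (ε * ξ)‖ ≤ (3 * b j) ^ p * A * D := by
          gcongr
          · linarith
          · exact hA ξ
          · exact hD _
      _ = b j ^ p * (3 ^ p * A * D) := by ring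
      _ ≤ b j ^ p * b j := by gcongr; exact (le_max_right _ _).trans hj
      _ = b j ^ (p + 1) := (pow_succ _ _).symm
      _ ≤ ε⁻¹ := hinv

/-- Complementary-ultrafilter case: the series defining `G` converges absolutely, `G` is
bounded and smooth, and for every `p` there is `N` such that
`⟨ξ⟩^p |G(ξ)| |(𝓕φ)(εξ)| ≤ ε⁻¹` for all `n ≥ N`, `ε ∈ (ε_{6n}, ε_{6n−3}]`, and all `ξ`. -/
theorem stmt18 (ψ φ : SchwartzMap ℝ ℂ) :
    (∀ ξ : ℝ, Summable (fun m : ℕ => ‖ψ (ξ - b m)‖)) ∧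
    (∃ C : ℝ, ∀ ξ : ℝ, ‖G ψ ξ‖ ≤ C) ∧
    ContDiff ℝ (⊤ : ℕ∞) (G ψ) ∧
    ∀ p : ℕ, ∃ N : ℕ, ∀ n : ℕ, N ≤ n →
      ∀ ε : ℝ, eps (6 * n) < ε → ε ≤ eps (6 * n - 3) →
        ∀ ξ : ℝ, (1 + ξ ^ 2) ^ ((p : ℝ) / 2) * ‖G ψ ξ‖ * ‖𝓕 (⇑φ) (ε * ξ)‖ ≤ ε⁻¹ := by
  obtain ⟨C, -, hC⟩ := exists_norm_G_le ψ
  refine ⟨summable_norm_translates ψ, ⟨C, hC⟩, contDiff_G ψ, fun p => ?_⟩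
  obtain ⟨N, hN⟩ := exists_forall_weighted_le_inv ψ (𝓕 φ) p
  refine ⟨N, fun n hn ε hε₁ hε₂ ξ => le_trans ?_ (hN n hn ε hε₁ hε₂ ξ)⟩
  rw [SchwartzMap.fourier_coe]
  gcongr
  exact one_add_sq_rpow_half_le ξ p
end
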